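/- arXiv:1201.4835 — 5 statements merged into one kernel-verified Lean document; each statement's English description precedes it below -/
import Mathlib

section
/- Let Ω ⊂ ℂ² be a bounded convex Reinhardt domain and, for w ∈ ℂ, set Δ_w = {z ∈ ℂ : (z, w) ∈ cl(Ω)}. Assume that for some w₀ ∈ ℂ the set Δ_{w₀} is nonempty and Δ_{w₀} × {w₀} ⊂ ∂Ω, and let {w_j} be a sequence of complex numbers converging to w₀ with Δ_{w_j} nonempty for all j. Each nonempty Δ_w is a closed disk centered at the origin; let r_j = sup{|z| : z ∈ Δ_{w_j}} be the radius of Δ_{w_j} and r₀ the radius of Δ_{w₀}. Then r_j → r₀ as j → ∞. -/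
open MeasureTheory Metric Complex Filter Set Topology

def IsReinhardt (Ω : Set (ℂ × ℂ)) : Prop :=
  ∀ p ∈ Ω, ∀ θ₁ θ₂ : ℝ, (Complex.exp (θ₁ * Complex.I) * (Prod.fst p),
    Complex.exp (θ₂ * Complex.I) * (Prod.snd p)) ∈ Ω

lemma exists_rot (a a' : ℂ) (h : ‖a'‖ = ‖a‖) : ∃ θ : ℝ, Complex.exp (θ * Complex.I) * a = a' := by
  by_cases ha : a = 0
  · subst ha
    refine ⟨0, ?_⟩
    have : a' = 0 := by simpa using h
    simp [this]
  · refine ⟨Complex.arg (a' / a), ?_⟩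
    have h1 := Complex.norm_mul_exp_arg_mul_I (a' / a)
    have h2 : ‖a' / a‖ = 1 := by
      rw [norm_div, h, div_self (norm_ne_zero_iff.mpr ha)]
    rw [h2] at h1
    simp only [ofReal_one, one_mul] at h1
    rw [h1, div_mul_cancel₀ _ ha]

lemma IsReinhardt.mem {S : Set (ℂ × ℂ)} (hS : IsReinhardt S) {a b a' b' : ℂ} (h : (a, b) ∈ S)
    (ha : ‖a'‖ = ‖a‖) (hb : ‖b'‖ = ‖b‖) : (a', b') ∈ S := by
  obtain ⟨θ₁, h1⟩ := exists_rot a a' ha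
  obtain ⟨θ₂, h2⟩ := exists_rot b b' hb
  have := hS _ h θ₁ θ₂
  simpa [h1, h2] using this

lemma IsReinhardt.closure' {S : Set (ℂ × ℂ)} (hS : IsReinhardt S) : IsReinhardt (closure S) := by
  intro p hp θ₁ θ₂
  have hm : MapsTo (fun p : ℂ × ℂ => (Complex.exp (θ₁ * Complex.I) * (Prod.fst p),
    Complex.exp (θ₂ * Complex.I) * (Prod.snd p))) S S := fun q hq => hS q hq θ₁ θ₂
  exact hm.closure (by fun_prop) hp

lemma IsReinhardt.mem_le {S : Set (ℂ × ℂ)} (hS : IsReinhardt S) (hc : Convex ℝ S)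
    {a b a' b' : ℂ} (h : (a, b) ∈ S)
    (ha : ‖a'‖ ≤ ‖a‖) (hb : ‖b'‖ ≤ ‖b‖) : (a', b') ∈ S := by
  have key2 : (a, b') ∈ S := by
    have hcs : Convex ℝ {y : ℂ | (a, y) ∈ S} := by
      intro x hx y hy s t hs ht hst
      have := hc hx hy hs ht hst
      simpa [← add_mul, Convex.combo_self hst, ← Complex.ofReal_add, hst] using this
    have hsub : sphere (0 : ℂ) ‖b‖ ⊆ {y : ℂ | (a, y) ∈ S} := by
      intro y hy
      exact hS.mem h rfl (by simpa using hy)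
    have := convexHull_min hsub hcs
    rw [convexHull_sphere_eq_closedBall 0 (norm_nonneg b)] at this
    exact this (by simpa using hb)
  have hcs : Convex ℝ {y : ℂ | (y, b') ∈ S} := by
    intro x hx y hy s t hs ht hst
    have := hc hx hy hs ht hst
    simpa [← add_mul, Convex.combo_self hst, ← Complex.ofReal_add, hst] using this
  have hsub : sphere (0 : ℂ) ‖a‖ ⊆ {y : ℂ | (y, b') ∈ S} := by
    intro y hy
    exact hS.mem key2 (by simpa using hy) rfl
  have := convexHull_min hsub hcs
  rw [convexHull_sphere_eq_closedBall 0 (norm_nonneg a)] at this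
  exact this (by simpa using ha)

/-- Radii of the horizontal slices `Δ_w = {z : (z,w) ∈ cl Ω}` converge to the radius of a
boundary disk `Δ_{w₀} × {w₀} ⊂ ∂Ω` as `w_j → w₀`. -/
theorem slice_radii_converge
    (Ω : Set (ℂ × ℂ)) (hΩopen : IsOpen Ω) (hΩne : Ω.Nonempty)
    (hΩconv : Convex ℝ Ω) (hΩbdd : Bornology.IsBounded Ω)
    (hΩRein : IsReinhardt Ω)
    (Δ : ℂ → Set ℂ) (hΔ : ∀ w, Δ w = {z : ℂ | (z, w) ∈ closure Ω})
    (w₀ : ℂ) (hw₀ne : (Δ w₀).Nonempty)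
    (hw₀bd : (Δ w₀) ×ˢ {w₀} ⊆ frontier Ω)
    (w : ℕ → ℂ) (hw : Tendsto w atTop (𝓝 w₀))
    (hwne : ∀ j, (Δ (w j)).Nonempty)
    (r : ℕ → ℝ) (hr : ∀ j, r j = sSup ((fun z => ‖z‖) '' Δ (w j)))
    (r₀ : ℝ) (hr₀ : r₀ = sSup ((fun z => ‖z‖) '' Δ w₀)) :
    Tendsto r atTop (𝓝 r₀) := by
  have hKR := hΩRein.closure'
  have hKc := hΩconv.closure
  have hKcomp : IsCompact (closure Ω) := hΩbdd.isCompact_closure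
  have h0 : ((0 : ℂ), (0 : ℂ)) ∈ Ω := by
    obtain ⟨⟨a, b⟩, hp⟩ := hΩne
    exact hΩRein.mem_le hΩconv hp (by simp) (by simp)
  have hbdd : ∀ v, BddAbove ((fun z => ‖z‖) '' Δ v) := by
    intro v
    obtain ⟨C, hC⟩ := hKcomp.isBounded.exists_norm_le
    refine ⟨C, ?_⟩
    rintro _ ⟨z, hz, rfl⟩
    rw [hΔ] at hz
    exact (norm_fst_le (z, v)).trans (hC _ hz)
  have hnorm : ∀ j, ‖w j‖ ≤ ‖w₀‖ := by
    intro j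
    by_contra! hlt
    obtain ⟨z, hz⟩ := hwne j
    obtain ⟨z₀, hz₀⟩ := hw₀ne
    rw [hΔ] at hz
    have hwj : 0 < ‖w j‖ := (norm_nonneg _).trans_lt hlt
    have ht1 : ‖w₀‖ / ‖w j‖ < 1 := (div_lt_one hwj).2 hlt
    have h0w : ((0 : ℂ), w₀) ∈ Δ w₀ ×ˢ ({w₀} : Set ℂ) := by
      refine ⟨?_, rfl⟩
      rw [hΔ] at hz₀ ⊢
      exact hKR.mem_le hKc hz₀ (by simp) le_rfl
    have hfr := hw₀bd h0w
    have hmem : ((0 : ℂ), w j) ∈ closure Ω := hKR.mem_le hKc hz (by simp) le_rfl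
    have hint := hΩconv.combo_interior_closure_mem_interior
      (a := 1 - ‖w₀‖ / ‖w j‖) (b := ‖w₀‖ / ‖w j‖) (hΩopen.interior_eq.symm ▸ h0) hmem
      (by linarith) (by positivity) (by ring)
    rw [hΩopen.interior_eq] at hint
    have hin : ((0 : ℂ), w₀) ∈ Ω := by
      refine hΩRein.mem_le hΩconv hint (by simp) ?_
      simp [hwj.ne']
    rw [hΩopen.frontier_eq] at hfr
    exact hfr.2 hin
  have hlow : ∀ j, r₀ ≤ r j := by
    intro j
    rw [hr, hr₀]
    refine csSup_le_csSup (hbdd _) (hw₀ne.image _) (image_mono ?_)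
    intro z hz
    rw [hΔ] at hz ⊢
    exact hKR.mem_le hKc hz le_rfl (hnorm j)
  rw [Metric.tendsto_atTop']
  intro ε hε
  set C : Set ℂ := Prod.snd '' (closure Ω ∩ {p : ℂ × ℂ | r₀ + ε / 2 ≤ ‖p.1‖}) with hC
  have hCc : IsClosed C := by
    refine (IsCompact.image (hKcomp.inter_right ?_) continuous_snd).isClosed
    exact isClosed_le continuous_const (by fun_prop)
  have hw₀C : w₀ ∉ C := by
    rintro ⟨⟨z, v⟩, ⟨hz, hzn⟩, rfl⟩
    have : ‖z‖ ≤ r₀ := by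
      rw [hr₀]
      exact le_csSup (hbdd _) ⟨z, by rw [hΔ]; exact hz, rfl⟩
    simp only [mem_setOf_eq] at hzn
    linarith
  obtain ⟨N, hN⟩ := eventually_atTop.1 (hw.eventually (hCc.isOpen_compl.mem_nhds hw₀C))
  refine ⟨N, fun j hj => ?_⟩
  have hup : r j ≤ r₀ + ε / 2 := by
    rw [hr]
    refine csSup_le ((hwne j).image _) ?_
    rintro _ ⟨z, hz, rfl⟩
    by_contra! hlt
    rw [hΔ] at hz
    exact hN j hj.le ⟨(z, w j), ⟨hz, hlt.le⟩, rfl⟩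
  rw [Real.dist_eq, abs_of_nonneg (by linarith [hlow j])]
  linarith
end

section
/- Let ψ ∈ L²(ℂ). For r > 0, let E_{𝔻_r}P^{𝔻_r}ψ denote the function on ℂ equal to P^{𝔻_r}(ψ|_{𝔻_r}) on 𝔻_r and equal to 0 outside 𝔻_r. Then ‖E_{𝔻_r}P^{𝔻_r}ψ − E_{𝔻}P^{𝔻}ψ‖_{L²(ℂ)} → 0 as r → 1. -/
open MeasureTheory Metric Complex Filter Set Topology

/-- The Bergman projection on the disk `𝔻_r`, given by the explicit Bergman kernel. -/
noncomputable def diskProj (r : ℝ) (u : ℂ → ℂ) (z : ℂ) : ℂ :=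
  (1 / Real.pi) * ∫ ξ in ball (0:ℂ) r,
    (r:ℂ)^2 / ((r:ℂ)^2 - z * (starRingEnd ℂ) ξ)^2 * u ξ


lemma bp_orth {m n : ℕ} (h : m ≠ n) :
    ∫ z in ball (0:ℂ) 1, (starRingEnd ℂ) (z ^ n) * z ^ m = 0 := by
  set d : ℝ := (m:ℝ) - n with hd
  have hd0 : d ≠ 0 := sub_ne_zero.2 (by exact_mod_cast h)
  set ω : Circle := Circle.exp (Real.pi / d) with hω
  have key : (starRingEnd ℂ) ((ω:ℂ) ^ n) * (ω:ℂ) ^ m = -1 := by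
    rw [hω, Circle.coe_exp, ← Complex.exp_nat_mul, ← Complex.exp_nat_mul, ← Complex.exp_conj,
      ← Complex.exp_add, ← Complex.exp_pi_mul_I]
    congr 1
    have hdc : (d:ℂ) ≠ 0 := by exact_mod_cast hd0
    simp only [map_mul, map_natCast, Complex.conj_ofReal, Complex.conj_I]
    push_cast
    field_simp
    rw [hd]; push_cast; ring
  have h1 := (rotation ω).measurePreserving.setIntegral_preimage_emb
    (rotation ω).toHomeomorph.measurableEmbedding
    (fun z : ℂ => (starRingEnd ℂ) (z ^ n) * z ^ m) (ball (0:ℂ) 1)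
  have hpre : (rotation ω) ⁻¹' ball (0:ℂ) 1 = ball 0 1 := by
    ext z; simp only [mem_preimage, mem_ball, dist_zero_right, LinearIsometryEquiv.norm_map]
  rw [hpre] at h1
  have h2 : ∀ z : ℂ, (starRingEnd ℂ) ((rotation ω z) ^ n) * (rotation ω z) ^ m
      = - ((starRingEnd ℂ) (z ^ n) * z ^ m) := by
    intro z
    rw [rotation_apply, mul_pow, mul_pow, map_mul]
    linear_combination ((starRingEnd ℂ) (z ^ n) * z ^ m) * key
  simp only [h2, integral_neg] at h1
  have := self_eq_neg.1 h1.symm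
  exact this

lemma bp_norm (n : ℕ) :
    ∫ z in ball (0:ℂ) 1, (starRingEnd ℂ) (z ^ n) * z ^ n = (Real.pi / (n + 1) : ℝ) := by
  have h0 : ∀ z : ℂ, (starRingEnd ℂ) (z ^ n) * z ^ n = ((‖z‖ ^ (2 * n) : ℝ) : ℂ) := by
    intro z
    rw [mul_comm, Complex.mul_conj, Complex.normSq_eq_norm_sq, norm_pow]
    congr 1; ring
  simp only [h0]
  rw [integral_complex_ofReal]
  congr 1
  rw [← integral_indicator measurableSet_ball]
  have h1 : ((ball (0:ℂ) 1).indicator fun z : ℂ => ‖z‖ ^ (2 * n))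
      = fun z => (Iio (1:ℝ)).indicator (fun t => t ^ (2 * n)) ‖z‖ := by
    ext z
    by_cases hz : ‖z‖ < 1
    · simp [indicator, hz]
    · simp [indicator, hz]
  rw [h1, integral_fun_norm_addHaar volume (fun t : ℝ => (Iio (1:ℝ)).indicator (fun t => t ^ (2 * n)) t)]
  have h2 : (fun y : ℝ => y ^ (Module.finrank ℝ ℂ - 1) • (Iio (1:ℝ)).indicator (fun t => t ^ (2 * n)) y)
     = (Iio (1:ℝ)).indicator (fun t => t ^ (2 * n + 1)) := by
    ext y
    by_cases hy : y < 1
    · simp [indicator, hy, Complex.finrank_real_complex]; ring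
    · simp [indicator, hy]
  rw [h2, setIntegral_indicator measurableSet_Iio, Ioi_inter_Iio, ← integral_Ioc_eq_integral_Ioo,
    ← intervalIntegral.integral_of_le zero_le_one, integral_pow]
  simp [Measure.real, Complex.volume_ball, Complex.finrank_real_complex]
  field_simp
  ring

local notation "μD" => (Measure.restrict (volume : Measure ℂ) (ball (0:ℂ) 1))

lemma bp_cmem (f : ℂ → ℂ) (hf : Continuous f) : MemLp f 2 μD := by
  have : MemLp f 2 (volume.restrict (closedBall (0:ℂ) 1)) := by
    haveI : IsFiniteMeasure (volume.restrict (closedBall (0:ℂ) 1)) := by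
      constructor
      simpa using measure_closedBall_lt_top
    obtain ⟨C, hC⟩ := (isCompact_closedBall (0:ℂ) 1).exists_bound_of_continuousOn hf.continuousOn
    refine MemLp.of_bound hf.aestronglyMeasurable C ?_
    exact ae_restrict_of_forall_mem measurableSet_closedBall hC
  exact this.mono_measure (Measure.restrict_mono ball_subset_closedBall le_rfl)

instance bp_fin : IsFiniteMeasure μD := by
  constructor
  simpa using measure_ball_lt_top

noncomputable def bpc (n : ℕ) : ℂ := ((Real.sqrt ((n + 1) / Real.pi) : ℝ) : ℂ)

lemma bpc_sq (n : ℕ) : bpc n * bpc n = (n + 1) / Real.pi := by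
  rw [bpc, ← Complex.ofReal_mul, Real.mul_self_sqrt (by positivity)]
  push_cast; rfl

lemma bp_emem (n : ℕ) : MemLp (fun z : ℂ => bpc n * z ^ n) 2 μD :=
  bp_cmem _ (by fun_prop)

noncomputable def bpe (n : ℕ) : Lp ℂ 2 μD := (bp_emem n).toLp _

lemma bpe_inner (n : ℕ) {u : ℂ → ℂ} (hu : MemLp u 2 μD) :
    inner ℂ (bpe n) (hu.toLp u) = bpc n * ∫ z in ball (0:ℂ) 1, (starRingEnd ℂ) (z ^ n) * u z := by
  rw [L2.inner_def, ← integral_const_mul]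
  apply integral_congr_ae
  filter_upwards [(bp_emem n).coeFn_toLp, hu.coeFn_toLp] with z h1 h2
  rw [bpe, h1, h2]
  simp [bpc]
  ring

lemma bpe_on : Orthonormal ℂ bpe := by
  classical
  rw [orthonormal_iff_ite]
  intro i j
  have : inner ℂ (bpe i) (bpe j) = bpc i * (bpc j * ∫ z in ball (0:ℂ) 1, (starRingEnd ℂ) (z ^ i) * z ^ j) := by
    conv_lhs => rw [bpe.eq_def j]
    rw [bpe_inner, ← integral_const_mul (bpc j)]
    congr 1
    refine integral_congr_ae (Eventually.of_forall fun z => ?_)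
    simp only []
    ring
  rw [this]
  split_ifs with h
  · subst h
    rw [bp_norm, ← mul_assoc, bpc_sq]
    have : (Real.pi : ℂ) ≠ 0 := by exact_mod_cast Real.pi_ne_zero
    have h' : (i : ℂ) + 1 ≠ 0 := by exact_mod_cast i.succ_ne_zero
    push_cast
    field_simp
  · rw [bp_orth (Ne.symm h)]; simp

noncomputable def bpS (u : ℂ → ℂ) (N : ℕ) (z : ℂ) : ℂ :=
  ∑ n ∈ Finset.range N, (bpc n * ∫ ξ in ball (0:ℂ) 1, (starRingEnd ℂ) (ξ ^ n) * u ξ) * (bpc n * z ^ n)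

lemma bpS_le {u : ℂ → ℂ} (hu : MemLp u 2 μD) (N : ℕ) : eLpNorm (bpS u N) 2 μD ≤ eLpNorm u 2 μD := by
  have hS : MemLp (bpS u N) 2 μD := bp_cmem _ (by unfold bpS; fun_prop)
  have e : hS.toLp _ = ∑ n ∈ Finset.range N, (inner ℂ (bpe n) (hu.toLp u)) • bpe n := by
    have : ∀ n, (inner ℂ (bpe n) (hu.toLp u)) • bpe n = ((bp_emem n).const_smul (inner ℂ (bpe n) (hu.toLp u))).toLp _ := by
      intro n; rw [MemLp.toLp_const_smul]; rfl
    apply Lp.ext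
    refine hS.coeFn_toLp.trans ?_
    refine EventuallyEq.trans ?_ (Lp.coeFn_finsetSum _ _).symm
    have h2 : ∀ᵐ z ∂μD, ∀ n, ((inner ℂ (bpe n) (hu.toLp u)) • bpe n : Lp ℂ 2 μD) z
        = (inner ℂ (bpe n) (hu.toLp u)) * (bpc n * z ^ n) := by
      rw [ae_all_iff]
      intro n
      rw [this]
      filter_upwards [((bp_emem n).const_smul (inner ℂ (bpe n) (hu.toLp u))).coeFn_toLp] with z hz
      rw [hz]; rfl
    filter_upwards [h2] with z hz
    rw [Finset.sum_apply]
    simp only [hz]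
    simp only [bpe_inner]
    rfl
  have hle : ‖hS.toLp _‖ ≤ ‖hu.toLp u‖ := by
    rw [← sq_le_sq₀ (norm_nonneg _) (norm_nonneg _)]
    refine le_trans (le_of_eq ?_) (bpe_on.sum_inner_products_le (s := Finset.range N) (hu.toLp u))
    rw [e]
    have := bpe_on.inner_sum (fun n => inner ℂ (bpe n) (hu.toLp u)) (fun n => inner ℂ (bpe n) (hu.toLp u)) (Finset.range N)
    rw [inner_self_eq_norm_sq_to_K] at this
    have h3 : ((‖∑ n ∈ Finset.range N, (inner ℂ (bpe n) (hu.toLp u)) • bpe n‖ ^ 2 : ℝ) : ℂ) = ((∑ i ∈ Finset.range N, ‖inner ℂ (bpe i) (hu.toLp u)‖ ^ 2 : ℝ) : ℂ) := by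
      push_cast
      refine Eq.trans this ?_
      refine Finset.sum_congr rfl fun i _ => ?_
      rw [mul_comm, Complex.mul_conj, Complex.normSq_eq_norm_sq]; push_cast; rfl
    exact_mod_cast h3
  rw [Lp.norm_toLp, Lp.norm_toLp] at hle
  exact (ENNReal.toReal_le_toReal hS.2.ne hu.2.ne).1 hle

lemma bp_int {u : ℂ → ℂ} (hu : MemLp u 2 μD) : Integrable u μD := hu.integrable (by norm_num)

lemma bp_lt {z ξ : ℂ} (hz : z ∈ ball (0:ℂ) 1) (hξ : ξ ∈ ball (0:ℂ) 1) :
    ‖z * (starRingEnd ℂ) ξ‖ < 1 := by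
  simp only [mem_ball, dist_zero_right] at hz hξ
  rw [norm_mul, RCLike.norm_conj]
  nlinarith [norm_nonneg z, norm_nonneg ξ]

lemma bp_tendsto {u : ℂ → ℂ} (hu : MemLp u 2 μD) {z : ℂ} (hz : z ∈ ball (0:ℂ) 1) :
    Tendsto (fun N => bpS u N z) atTop (𝓝 (diskProj 1 u z)) := by
  have hz' : ‖(‖z‖:ℝ)‖ < 1 := by simpa using hz
  have hs := hasSum_choose_mul_geometric_of_norm_lt_one 1 hz'
  simp only [Nat.choose_one_right] at hs
  have H : HasSum (fun n : ℕ => ∫ ξ in ball (0:ℂ) 1, (((n + 1 : ℕ) : ℂ) * (z * (starRingEnd ℂ) ξ) ^ n) * u ξ)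
      (∫ ξ in ball (0:ℂ) 1, (((1:ℝ):ℂ) ^ 2 / (((1:ℝ):ℂ) ^ 2 - z * (starRingEnd ℂ) ξ) ^ 2 * u ξ)) := by
    apply hasSum_integral_of_dominated_convergence
      (fun (n : ℕ) ξ => (((n + 1 : ℕ) : ℝ) * ‖z‖ ^ n) * ‖u ξ‖)
    · intro n
      refine AEStronglyMeasurable.mul ?_ hu.1
      exact Continuous.aestronglyMeasurable (by fun_prop)
    · intro n
      refine ae_restrict_of_forall_mem measurableSet_ball fun ξ hξ => ?_
      simp only [mem_ball, dist_zero_right] at hξ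
      rw [norm_mul, norm_mul, norm_pow, norm_mul, RCLike.norm_conj, Complex.norm_natCast]
      gcongr
      exact mul_le_of_le_one_right (norm_nonneg _) hξ.le
    · exact Eventually.of_forall fun ξ => (hs.mul_right _).summable
    · simp_rw [fun ξ => (hs.mul_right (‖u ξ‖)).tsum_eq]
      exact (bp_int hu).norm.const_mul _
    · refine ae_restrict_of_forall_mem measurableSet_ball fun ξ hξ => ?_
      have := (hasSum_choose_mul_geometric_of_norm_lt_one 1 (bp_lt hz hξ)).mul_right (u ξ)
      simp only [Nat.choose_one_right] at this
      simpa using this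
  have := (H.mul_left (1 / (Real.pi : ℂ))).tendsto_sum_nat
  refine this.congr fun N => ?_
  unfold bpS
  refine Finset.sum_congr rfl fun n _ => ?_
  have : ∀ ξ : ℂ, (((n + 1 : ℕ) : ℂ) * (z * (starRingEnd ℂ) ξ) ^ n) * u ξ
     = (((n + 1 : ℕ) : ℂ) * z ^ n) * ((starRingEnd ℂ) (ξ ^ n) * u ξ) := by
    intro ξ; rw [mul_pow, map_pow]; ring
  simp only [this]
  rw [integral_const_mul]
  have h3 := bpc_sq n
  push_cast
  linear_combination (-(∫ ξ in ball (0:ℂ) 1, (starRingEnd ℂ) (ξ ^ n) * u ξ) * z ^ n) * h3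

noncomputable def bpT (u : ℂ → ℂ) : ℂ → ℂ := (ball (0:ℂ) 1).indicator (diskProj 1 u)

lemma bpT_memLp {u : ℂ → ℂ} (hu : MemLp u 2 volume) :
    MemLp (bpT u) 2 volume ∧ eLpNorm (bpT u) 2 volume ≤ eLpNorm u 2 volume := by
  have hu' : MemLp u 2 μD := hu.restrict _
  have hm : ∀ N, AEStronglyMeasurable (bpS u N) μD := fun N =>
    Continuous.aestronglyMeasurable (by unfold bpS; fun_prop)
  have hlim : ∀ᵐ z ∂μD, Tendsto (fun N => bpS u N z) atTop (𝓝 (diskProj 1 u z)) :=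
    ae_restrict_of_forall_mem measurableSet_ball fun z hz => bp_tendsto hu' hz
  have h1 : eLpNorm (bpT u) 2 volume ≤ eLpNorm u 2 volume := by
    rw [bpT, eLpNorm_indicator_eq_eLpNorm_restrict measurableSet_ball]
    refine (Lp.eLpNorm_lim_le_liminf_eLpNorm hm _ hlim).trans ?_
    refine le_trans ?_ (eLpNorm_mono_measure u (Measure.restrict_le_self (s := ball (0:ℂ) 1)))
    refine (liminf_le_liminf (Eventually.of_forall fun N => bpS_le hu' N)).trans ?_
    simp
  refine ⟨⟨?_, h1.trans_lt hu.2⟩, h1⟩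
  rw [bpT, aestronglyMeasurable_indicator_iff measurableSet_ball]
  exact aestronglyMeasurable_of_tendsto_ae _ hm hlim

lemma bp_kint {u : ℂ → ℂ} (hu : MemLp u 2 μD) {z : ℂ} (hz : z ∈ ball (0:ℂ) 1) :
    Integrable (fun ξ => ((1:ℝ):ℂ) ^ 2 / (((1:ℝ):ℂ) ^ 2 - z * (starRingEnd ℂ) ξ) ^ 2 * u ξ) μD := by
  have hz' : ‖z‖ < 1 := by simpa using hz
  refine (bp_int hu).bdd_mul (c := 1 / (1 - ‖z‖) ^ 2) ?_ ?_
  · exact Measurable.aestronglyMeasurable (by fun_prop)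
  · refine ae_restrict_of_forall_mem measurableSet_ball fun ξ hξ => ?_
    simp only [mem_ball, dist_zero_right] at hξ
    simp only [Complex.ofReal_one, one_pow, norm_div, norm_one, norm_pow]
    have : 0 < 1 - ‖z‖ := by linarith
    gcongr
    have h1 := norm_sub_norm_le (1:ℂ) (z * (starRingEnd ℂ) ξ)
    have h2 : ‖z * (starRingEnd ℂ) ξ‖ ≤ ‖z‖ := by
      rw [norm_mul, RCLike.norm_conj]
      exact mul_le_of_le_one_right (norm_nonneg _) hξ.le
    rw [norm_one] at h1
    linarith

lemma bpT_sub {u v : ℂ → ℂ} (hu : MemLp u 2 volume) (hv : MemLp v 2 volume) :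
    bpT (u - v) = bpT u - bpT v := by
  ext z
  by_cases hz : z ∈ ball (0:ℂ) 1
  · simp only [bpT, Pi.sub_apply, indicator_of_mem hz, diskProj]
    rw [← mul_sub, ← integral_sub (bp_kint (hu.restrict _) hz) (bp_kint (hv.restrict _) hz)]
    simp only [mul_sub]
  · simp [bpT, hz]

lemma bp_dil_norm (f : ℂ → ℂ) {r : ℝ} (hr : 1 / 2 < r) :
    eLpNorm (fun z => f (r • z)) 2 volume ≤ 2 * eLpNorm f 2 volume := by
  have hr0 : r ≠ 0 := by linarith
  have hme : MeasurableEmbedding (fun z : ℂ => r • z) :=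
    (Homeomorph.smulOfNeZero r hr0).measurableEmbedding
  have h := hme.eLpNorm_map_measure (g := f) (p := 2) (μ := (volume : Measure ℂ))
  rw [Measure.map_addHaar_smul volume hr0, eLpNorm_smul_measure_of_ne_top (by norm_num)] at h
  change _ = eLpNorm (fun z => f (r • z)) 2 volume at h
  rw [← h, smul_eq_mul]
  gcongr
  have h1 : ENNReal.ofReal |(r ^ Module.finrank ℝ ℂ)⁻¹| ≤ 2 ^ (2:ℝ) := by
    rw [Complex.finrank_real_complex, abs_of_pos (by positivity)]
    have : (r ^ 2)⁻¹ ≤ 4 := by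
      rw [inv_le_comm₀ (by positivity) (by norm_num)]
      nlinarith
    refine (ENNReal.ofReal_le_ofReal this).trans ?_
    norm_num
  refine (ENNReal.rpow_le_rpow h1 (by positivity)).trans ?_
  rw [← ENNReal.rpow_mul]
  norm_num

lemma bp_dil_mem {f : ℂ → ℂ} (hf : MemLp f 2 volume) {r : ℝ} (hr : 1 / 2 < r) :
    MemLp (fun z => f (r • z)) 2 volume := by
  refine ⟨?_, (bp_dil_norm f hr).trans_lt (ENNReal.mul_lt_top (by norm_num) hf.2)⟩
  have hr0 : r ≠ 0 := by linarith
  refine hf.1.comp_quasiMeasurePreserving (f := fun z : ℂ => r • z) ⟨by fun_prop, ?_⟩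
  rw [Measure.map_addHaar_smul volume hr0]
  exact Measure.smul_absolutelyContinuous

lemma bp_dil_cc {g : ℂ → ℂ} (hg : Continuous g) (hc : HasCompactSupport g) :
    Tendsto (fun r : ℝ => eLpNorm (fun z => g (r • z) - g z) 2 volume) (𝓝 1) (𝓝 0) := by
  obtain ⟨R, hR⟩ : ∃ R : ℝ, ∀ z, R < ‖z‖ → g z = 0 := by
    obtain ⟨R, hR⟩ := hc.isCompact.isBounded.subset_closedBall 0
    refine ⟨R, fun z hz => ?_⟩
    by_contra hne
    have := hR (subset_tsupport g hne)
    simp at this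
    linarith
  have hu := hg.uniformContinuous_of_tendsto_cocompact hc.is_zero_at_infty
  set K : Set ℂ := closedBall 0 (2 * |R|) with hK
  have hKfin : volume K < ⊤ := measure_closedBall_lt_top
  set c : ENNReal := volume K ^ (1 / (2:ENNReal).toReal) with hcdef
  have hcfin : c ≠ ⊤ := ENNReal.rpow_ne_top_of_nonneg (by positivity) hKfin.ne
  have key : ∀ δ : ℝ, 0 < δ → ∀ᶠ r : ℝ in 𝓝 1,
      eLpNorm (fun z => g (r • z) - g z) 2 volume ≤ ENNReal.ofReal δ * c := by
    intro δ hδ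
    obtain ⟨η, hη, H⟩ := Metric.uniformContinuous_iff.1 hu δ hδ
    have hcont : Tendsto (fun r : ℝ => |r - 1| * (2 * |R|)) (𝓝 1) (𝓝 0) := by
      have : Continuous (fun r : ℝ => |r - 1| * (2 * |R|)) := by fun_prop
      simpa using this.tendsto 1
    filter_upwards [hcont.eventually (gt_mem_nhds hη), lt_mem_nhds (show (1/2:ℝ) < 1 by norm_num)] with r h1 h2
    have : eLpNorm (fun z => g (r • z) - g z) 2 volume ≤ eLpNorm (K.indicator fun _ => δ) 2 volume := by
      refine eLpNorm_mono_real fun z => ?_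
      by_cases hz : z ∈ K
      · rw [indicator_of_mem hz, ← dist_eq_norm]
        refine (H ?_).le
        rw [dist_eq_norm]
        have : r • z - z = (r - 1) • z := by rw [sub_smul, one_smul]
        rw [this, norm_smul, Real.norm_eq_abs]
        refine lt_of_le_of_lt ?_ h1
        gcongr
        simpa [hK] using hz
      · have hz' : 2 * |R| < ‖z‖ := by simpa [hK] using hz
        have hRR := le_abs_self R
        have h0 := abs_nonneg R
        rw [indicator_of_notMem hz, hR z (by linarith), hR (r • z), sub_zero, norm_zero]
        rw [norm_smul, Real.norm_eq_abs, abs_of_pos (by linarith)]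
        nlinarith
    refine this.trans ?_
    rw [eLpNorm_indicator_const measurableSet_closedBall (by norm_num) (by norm_num),
      Real.enorm_eq_ofReal hδ.le]
  rw [ENNReal.tendsto_nhds_zero]
  intro ε hε
  have ht : Tendsto (fun δ : ℝ => ENNReal.ofReal δ * c) (𝓝[>] 0) (𝓝 0) := by
    have h1 : Tendsto (fun δ : ℝ => ENNReal.ofReal δ) (𝓝[>] 0) (𝓝 0) := by
      have := (ENNReal.continuous_ofReal.tendsto 0).mono_left (nhdsWithin_le_nhds (s := Ioi 0))
      simpa using this
    simpa using ENNReal.Tendsto.mul_const h1 (Or.inr hcfin)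
  obtain ⟨δ, h1, h2⟩ := ((ENNReal.tendsto_nhds_zero.1 ht ε hε).and self_mem_nhdsWithin).exists
  filter_upwards [key δ h2] with r hr
  exact hr.trans h1

lemma bp_dil {f : ℂ → ℂ} (hf : MemLp f 2 volume) :
    Tendsto (fun r : ℝ => eLpNorm (fun z => f (r • z) - f z) 2 volume) (𝓝 1) (𝓝 0) := by
  rw [ENNReal.tendsto_nhds_zero]
  intro ε hε
  have hε4 : ε / 4 ≠ 0 := (ENNReal.div_pos hε.ne' (by norm_num)).ne'
  obtain ⟨g, hc, hfg, hg, hgm⟩ := hf.exists_hasCompactSupport_eLpNorm_sub_le (by norm_num) hε4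
  filter_upwards [ENNReal.tendsto_nhds_zero.1 (bp_dil_cc hg hc) (ε / 4) (pos_iff_ne_zero.2 hε4),
    lt_mem_nhds (show (1/2:ℝ) < 1 by norm_num)] with r h1 h2
  have m1 := (bp_dil_mem (hf.sub hgm) h2)
  have m2 := (bp_dil_mem hgm h2).sub hgm
  have m3 := hgm.sub hf
  have e : (fun z => f (r • z) - f z) = ((fun z => (f - g) (r • z)) + ((fun z => g (r • z)) - g)) + (g - f) := by
    ext z; simp
  rw [e]
  calc _ ≤ eLpNorm (fun z => (f - g) (r • z)) 2 volume + eLpNorm ((fun z => g (r • z)) - g) 2 volume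
          + eLpNorm (g - f) 2 volume := by
        refine (eLpNorm_add_le (m1.1.add m2.1) m3.1 (by norm_num)).trans ?_
        gcongr
        exact eLpNorm_add_le m1.1 m2.1 (by norm_num)
    _ ≤ 2 * (ε / 4) + ε / 4 + ε / 4 := by
        gcongr
        · exact (bp_dil_norm _ h2).trans (by gcongr)
        · exact h1
        · rw [eLpNorm_sub_comm]; exact hfg
    _ = ε := by
        have : 2 * (ε / 4) + ε / 4 + ε / 4 = 4 * (ε / 4) := by ring
        rw [this, ENNReal.mul_div_cancel (by norm_num) (by norm_num)]

lemma bp_scale (ψ : ℂ → ℂ) {r : ℝ} (hr : 0 < r) (z : ℂ) :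
    (ball (0:ℂ) r).indicator (diskProj r ψ) z = bpT (fun w => ψ (r • w)) (r⁻¹ • z) := by
  have hmem : r⁻¹ • z ∈ ball (0:ℂ) 1 ↔ z ∈ ball (0:ℂ) r := by
    simp only [mem_ball, dist_zero_right, norm_smul, norm_inv, Real.norm_eq_abs, abs_of_pos hr]
    rw [inv_mul_lt_iff₀ hr, mul_one]
  by_cases hz : z ∈ ball (0:ℂ) r
  · rw [bpT, indicator_of_mem hz, indicator_of_mem (hmem.2 hz), diskProj, diskProj]
    congr 1
    have h := Measure.setIntegral_comp_smul_of_pos volume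
      (fun ξ : ℂ => (r:ℂ)^2 / ((r:ℂ)^2 - z * (starRingEnd ℂ) ξ)^2 * ψ ξ) (ball (0:ℂ) 1) hr
    rw [smul_unitBall_of_pos hr, Complex.finrank_real_complex, eq_inv_smul_iff₀ (by positivity),
      ← integral_smul] at h
    rw [← h]
    congr 1
    ext ξ
    have hrc : (r:ℂ) ≠ 0 := by exact_mod_cast hr.ne'
    simp only [Complex.real_smul, map_mul, Complex.conj_ofReal, Complex.ofReal_pow, Complex.ofReal_inv,
      Complex.ofReal_one, one_pow]
    rw [← mul_assoc]
    congr 1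
    have : (r:ℂ)^2 - z * (r * (starRingEnd ℂ) ξ) = r ^ 2 * (1 - (r:ℂ)⁻¹ * z * (starRingEnd ℂ) ξ) := by
      field_simp
    rw [this, mul_pow, ← mul_div_assoc, ← sq, ← mul_div_mul_left 1 _ (pow_ne_zero 2 (pow_ne_zero 2 hrc)), mul_one]
  · rw [bpT, indicator_of_notMem hz, indicator_of_notMem (fun h => hz (hmem.1 h))]

/-- `‖E_{𝔻_r} P^{𝔻_r} ψ − E_𝔻 P^𝔻 ψ‖_{L²(ℂ)} → 0` as `r → 1`. -/
theorem extended_disk_projections_converge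
    (ψ : ℂ → ℂ) (hψ : MemLp ψ 2 (volume : Measure ℂ)) :
    Tendsto (fun r : ℝ => eLpNorm
        (fun z => (ball (0:ℂ) r).indicator (diskProj r ψ) z
          - (ball (0:ℂ) 1).indicator (diskProj 1 ψ) z) 2 (volume : Measure ℂ))
      (𝓝 1) (𝓝 0) := by
  have hT := bpT_memLp hψ
  have hinv : Tendsto (fun r : ℝ => r⁻¹) (𝓝 1) (𝓝 1) := by
    simpa using (continuousAt_inv₀ (one_ne_zero (α := ℝ))).tendsto
  have hlim : Tendsto (fun r : ℝ => 2 * eLpNorm (fun z => ψ (r • z) - ψ z) 2 volume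
      + eLpNorm (fun z => bpT ψ (r⁻¹ • z) - bpT ψ z) 2 volume) (𝓝 1) (𝓝 0) := by
    have h1 := ENNReal.Tendsto.const_mul (a := 2) (bp_dil hψ) (Or.inr (by norm_num))
    have h2 := (bp_dil hT.1).comp hinv
    simpa using h1.add h2
  refine tendsto_of_tendsto_of_tendsto_of_le_of_le' tendsto_const_nhds hlim
    (Eventually.of_forall fun _ => zero_le) ?_
  filter_upwards [lt_mem_nhds (show (1/2:ℝ) < 1 by norm_num),
    hinv.eventually (lt_mem_nhds (show (1/2:ℝ) < 1 by norm_num))] with r h1 h2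
  have hd := bp_dil_mem hψ h1
  have hds := hd.sub hψ
  have e : (fun z => (ball (0:ℂ) r).indicator (diskProj r ψ) z
          - (ball (0:ℂ) 1).indicator (diskProj 1 ψ) z)
      = (fun z => bpT ((fun w => ψ (r • w)) - ψ) (r⁻¹ • z)) + ((fun z => bpT ψ (r⁻¹ • z)) - bpT ψ) := by
    ext z
    rw [bp_scale ψ (by linarith) z, bpT_sub hd hψ]
    simp [bpT]
  rw [e]
  refine (eLpNorm_add_le (bp_dil_mem (bpT_memLp hds).1 h2).1
    ((bp_dil_mem hT.1 h2).sub hT.1).1 (by norm_num)).trans ?_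
  gcongr
  · exact (bp_dil_norm _ h2).trans (by gcongr; exact (bpT_memLp hds).2)
  · exact le_rfl
end

section
/- Let ψ ∈ L²(ℂ) and let K be a compact subset of 𝔻. Then P^{𝔻_r}(ψ|_{𝔻_r}) converges uniformly on K to P^{𝔻}(ψ|_{𝔻}) as r → 1 (for r close enough to 1 that K ⊂ 𝔻_r). -/
open MeasureTheory Metric Complex Filter Set Topology

lemma denom_bound {ρ r : ℝ} (hr : ρ < r) (hr0 : 0 < r) (z ξ : ℂ) (hz : ‖z‖ ≤ ρ) (hξ : ‖ξ‖ ≤ r) :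
    r * (r - ρ) ≤ ‖(r:ℂ)^2 - z * (starRingEnd ℂ) ξ‖ := by
  have h1 := norm_sub_norm_le ((r:ℂ)^2) (z * (starRingEnd ℂ) ξ)
  have h2 : ‖(r:ℂ)^2‖ = r^2 := by
    rw [norm_pow, Complex.norm_real, Real.norm_eq_abs, sq_abs]
  have h3 : ‖z * (starRingEnd ℂ) ξ‖ ≤ ρ * r := by
    rw [norm_mul, RCLike.norm_conj]
    exact mul_le_mul hz hξ (norm_nonneg _) ((norm_nonneg _).trans hz)
  nlinarith

lemma diskProj_continuousAt (ψ : ℂ → ℂ) (hψ : MemLp ψ 2 (volume : Measure ℂ))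
    (z₀ : ℂ) (hz₀ : ‖z₀‖ < 1) :
    ContinuousAt (fun p : ℝ × ℂ => diskProj p.1 ψ p.2) (1, z₀) := by
  unfold diskProj
  apply ContinuousAt.mul continuousAt_const
  simp_rw [← integral_indicator (measurableSet_ball (x := (0:ℂ)))]
  obtain ⟨ρ, hρ0, hρ1⟩ := exists_between hz₀
  obtain ⟨s, hs0, hs1⟩ := exists_between hρ1
  have hρ : 0 < ρ := (norm_nonneg _).trans_lt hρ0
  have hc : 0 < s * (s - ρ) := mul_pos (by linarith) (by linarith)
  have ev : ∀ᶠ p : ℝ × ℂ in 𝓝 (1, z₀), s < p.1 ∧ p.1 < 2 ∧ ‖p.2‖ < ρ := by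
    have a1 : ContinuousAt (fun p : ℝ × ℂ => p.1) (1, z₀) := continuousAt_fst
    have a2 : ContinuousAt (fun p : ℝ × ℂ => ‖p.2‖) (1, z₀) := continuousAt_snd.norm
    exact (a1.eventually (lt_mem_nhds hs1)).and
      ((a1.eventually (gt_mem_nhds (by norm_num : (1:ℝ) < 2))).and
        (a2.eventually (gt_mem_nhds hρ0)))
  apply continuousAt_of_dominated
    (bound := (ball (0:ℂ) 2).indicator (fun ξ => 4 / (s * (s - ρ))^2 * ‖ψ ξ‖))
  · refine Eventually.of_forall fun p => ?_
    refine AEStronglyMeasurable.indicator ?_ measurableSet_ball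
    refine AEStronglyMeasurable.mul ?_ hψ.1
    apply Measurable.aestronglyMeasurable
    have : Measurable (fun ξ : ℂ => (starRingEnd ℂ) ξ) := Complex.continuous_conj.measurable
    fun_prop
  · filter_upwards [ev] with p hp
    obtain ⟨h1, h2, h3⟩ := hp
    refine Eventually.of_forall fun ξ => ?_
    by_cases hξ : ξ ∈ ball (0:ℂ) p.1
    · have hξ' : ‖ξ‖ < p.1 := by simpa using hξ
      have hξ2 : ξ ∈ ball (0:ℂ) 2 := by simpa using hξ'.trans h2
      rw [indicator_of_mem hξ, indicator_of_mem hξ2, norm_mul]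
      refine mul_le_mul_of_nonneg_right ?_ (norm_nonneg _)
      have hd := denom_bound (by linarith) (by linarith) p.2 ξ h3.le hξ'.le
      rw [norm_div, norm_pow, norm_pow, Complex.norm_real, Real.norm_eq_abs, sq_abs]
      have hd2 : s * (s - ρ) ≤ p.1 * (p.1 - ρ) := by
        apply mul_le_mul <;> linarith
      have hd3 := hd2.trans hd
      apply div_le_div₀ (by norm_num) (by nlinarith) (by positivity)
      exact pow_le_pow_left₀ hc.le hd3 2
    · rw [indicator_of_notMem hξ, norm_zero]
      exact indicator_nonneg (fun ξ _ => by positivity) _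
  · rw [integrable_indicator_iff measurableSet_ball]
    have : IsFiniteMeasure ((volume : Measure ℂ).restrict (ball (0:ℂ) 2)) :=
      ⟨by rw [Measure.restrict_apply_univ]; exact measure_ball_lt_top⟩
    exact (((hψ.restrict (ball (0:ℂ) 2)).integrable (by norm_num)).norm).const_mul _
  · have hsph : ∀ᵐ ξ : ℂ ∂volume, ξ ∉ sphere (0:ℂ) 1 :=
      measure_eq_zero_iff_ae_notMem.1 (Measure.addHaar_sphere volume (0:ℂ) 1)
    filter_upwards [hsph] with ξ hξ
    have hξ1 : ‖ξ‖ ≠ 1 := by simpa using hξ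
    have a1 : ContinuousAt (fun p : ℝ × ℂ => p.1) (1, z₀) := continuousAt_fst
    rcases lt_or_gt_of_ne hξ1 with h | h
    · have e : (fun p : ℝ × ℂ => (p.1:ℂ)^2 / ((p.1:ℂ)^2 - p.2 * (starRingEnd ℂ) ξ)^2 * ψ ξ)
          =ᶠ[𝓝 (1, z₀)] (fun p : ℝ × ℂ => (ball (0:ℂ) p.1).indicator
            (fun ξ => (p.1:ℂ)^2 / ((p.1:ℂ)^2 - p.2 * (starRingEnd ℂ) ξ)^2 * ψ ξ) ξ) := by
        filter_upwards [a1.eventually (lt_mem_nhds h)] with p hp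
        rw [indicator_of_mem (by simpa using hp)]
      refine ContinuousAt.congr ?_ e
      have hd := denom_bound hρ1 one_pos z₀ ξ hρ0.le h.le
      refine ContinuousAt.mul (ContinuousAt.div (by fun_prop) (by fun_prop) ?_) continuousAt_const
      apply pow_ne_zero
      apply norm_pos_iff.1
      simp only at hd ⊢
      linarith
    · have e : (fun p : ℝ × ℂ => (0:ℂ))
          =ᶠ[𝓝 (1, z₀)] (fun p : ℝ × ℂ => (ball (0:ℂ) p.1).indicator
            (fun ξ => (p.1:ℂ)^2 / ((p.1:ℂ)^2 - p.2 * (starRingEnd ℂ) ξ)^2 * ψ ξ) ξ) := by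
        filter_upwards [a1.eventually (gt_mem_nhds h)] with p hp
        rw [indicator_of_notMem (by simpa using hp.le)]
      exact ContinuousAt.congr continuousAt_const e

/-- `P^{𝔻_r} ψ → P^𝔻 ψ` uniformly on compact subsets of `𝔻` as `r → 1`. -/
theorem disk_projections_converge_uniformly_on_compacts
    (ψ : ℂ → ℂ) (hψ : MemLp ψ 2 (volume : Measure ℂ))
    (K : Set ℂ) (hK : IsCompact K) (hK𝔻 : K ⊆ ball (0:ℂ) 1) :
    TendstoUniformlyOn (fun (r : ℝ) (z : ℂ) => diskProj r ψ z) (diskProj 1 ψ)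
      (𝓝 1) K := by
  rw [← tendstoLocallyUniformlyOn_iff_tendstoUniformlyOn_of_compact hK,
    Metric.tendstoLocallyUniformlyOn_iff]
  intro ε hε z₀ hz₀
  have hc := diskProj_continuousAt ψ hψ z₀ (by simpa using hK𝔻 hz₀)
  have h := Metric.continuousAt_iff'.1 hc (ε / 2) (half_pos hε)
  rw [nhds_prod_eq] at h
  obtain ⟨pa, ha, pb, hb, hab⟩ := eventually_prod_iff.1 h
  refine ⟨{y | pb y}, mem_nhdsWithin_of_mem_nhds hb, ?_⟩
  filter_upwards [ha] with r hr y hy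
  have h1 := hab ha.self_of_nhds hy
  have h2 := hab hr hy
  simp only at h1 h2
  calc _ ≤ _ := dist_triangle_right _ _ (diskProj 1 ψ z₀)
    _ < ε := by linarith
end

section
/- Let U ⊂ ℂ be a bounded convex domain and let f be holomorphic on U with ∫_U |f|² dA < ∞. Then for every ε > 0 there exists a holomorphic polynomial h ∈ ℂ[z] such that ‖f − h‖_{L²(U)} < ε. -/
open MeasureTheory Metric Complex Filter Set Topology

/-- uniform approximability by polynomials on `U` -/
def PolyApprox (U : Set ℂ) (F : ℂ → ℂ) : Prop :=
  ∀ ε > (0:ℝ), ∃ p : Polynomial ℂ, ∀ z ∈ U, ‖F z - p.eval z‖ ≤ ε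

lemma PolyApprox.zero (U : Set ℂ) : PolyApprox U (fun _ => 0) := fun ε hε =>
  ⟨0, fun z _ => by simpa using hε.le⟩

lemma PolyApprox.const (U : Set ℂ) (c : ℂ) : PolyApprox U (fun _ => c) := fun ε hε =>
  ⟨Polynomial.C c, fun z _ => by simpa using hε.le⟩

lemma PolyApprox.add {U : Set ℂ} {F G : ℂ → ℂ} (hF : PolyApprox U F) (hG : PolyApprox U G) :
    PolyApprox U (fun z => F z + G z) := by
  intro ε hε
  obtain ⟨p, hp⟩ := hF (ε / 2) (by positivity)
  obtain ⟨q, hq⟩ := hG (ε / 2) (by positivity)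
  refine ⟨p + q, fun z hz => ?_⟩
  rw [Polynomial.eval_add, add_sub_add_comm]
  linarith [norm_add_le (F z - p.eval z) (G z - q.eval z), hp z hz, hq z hz]

lemma PolyApprox.sum {U : Set ℂ} {F : ℕ → ℂ → ℂ} (hF : ∀ n, PolyApprox U (F n)) (N : ℕ) :
    PolyApprox U (fun z => ∑ n ∈ Finset.range N, F n z) := by
  induction N with
  | zero => simpa using PolyApprox.zero U
  | succ N ih =>
    simp only [Finset.sum_range_succ]
    exact ih.add (hF N)

lemma PolyApprox.monomial_mul {U : Set ℂ} {F : ℂ → ℂ} {R : ℝ} (hR : ∀ z ∈ U, ‖z‖ ≤ R)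
    (hR0 : 0 < R) (hF : PolyApprox U F) (c : ℂ) (k : ℕ) :
    PolyApprox U (fun z => c * z ^ k * F z) := by
  intro ε hε
  obtain ⟨p, hp⟩ := hF (ε / ((‖c‖ + 1) * R ^ k)) (by positivity)
  refine ⟨Polynomial.C c * Polynomial.X ^ k * p, fun z hz => ?_⟩
  have h1 : c * z ^ k * F z - (Polynomial.C c * Polynomial.X ^ k * p).eval z
      = c * z ^ k * (F z - p.eval z) := by
    simp; ring
  rw [h1, norm_mul, norm_mul, norm_pow]
  have h2 : ‖c‖ * ‖z‖ ^ k ≤ (‖c‖ + 1) * R ^ k := by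
    gcongr
    · linarith
    · exact hR z hz
  calc ‖c‖ * ‖z‖ ^ k * ‖F z - p.eval z‖
      ≤ ((‖c‖ + 1) * R ^ k) * (ε / ((‖c‖ + 1) * R ^ k)) := by
        gcongr
        exact hp z hz
    _ = ε := by field_simp

lemma PolyApprox.of_tendsto {U : Set ℂ} {F : ℕ → ℂ → ℂ} {G : ℂ → ℂ}
    (hF : ∀ n, PolyApprox U (F n)) (h : TendstoUniformlyOn F G atTop U) : PolyApprox U G := by
  intro ε hε
  obtain ⟨n, hn⟩ := (Metric.tendstoUniformlyOn_iff.1 h (ε / 2) (by positivity)).exists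
  obtain ⟨p, hp⟩ := hF n (ε / 2) (by positivity)
  refine ⟨p, fun z hz => ?_⟩
  have h1 := hn z hz
  rw [dist_eq_norm] at h1
  have h2 := hp z hz
  calc ‖G z - p.eval z‖ = ‖(G z - F n z) + (F n z - p.eval z)‖ := by congr 1; ring
    _ ≤ _ := norm_add_le _ _
    _ ≤ ε := by linarith

lemma differentiableOn_iteratedDeriv_aux {U : Set ℂ} (hU : IsOpen U) {g : ℂ → ℂ}
    (hg : DifferentiableOn ℂ g U) (k : ℕ) : DifferentiableOn ℂ (iteratedDeriv k g) U := by
  induction k with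
  | zero => simpa using hg
  | succ k ih =>
    rw [iteratedDeriv_succ]
    exact ih.deriv hU

lemma runge_step {U : Set ℂ} (hU : IsOpen U) {R : ℝ} (hR : ∀ z ∈ U, ‖z‖ ≤ R) (hR0 : 0 < R)
    {K : Set ℂ} (hK : IsCompact K) (hKU : K ⊆ U) {δ : ℝ} (hδ : 0 < δ) {t s : ℝ}
    (hs : 0 ≤ s) (hsR : s * R ≤ δ / 2)
    (hball : ∀ z ∈ U, closedBall ((t : ℂ) * z) δ ⊆ K)
    (ih : ∀ g : ℂ → ℂ, DifferentiableOn ℂ g U → PolyApprox U (fun z => g (t * z)))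
    (g : ℂ → ℂ) (hg : DifferentiableOn ℂ g U) :
    PolyApprox U (fun z => g (((t + s : ℝ) : ℂ) * z)) := by
  obtain ⟨M, hM⟩ := hK.exists_bound_of_continuousOn (hg.continuousOn.mono hKU)
  let T : ℕ → ℂ → ℂ := fun k z =>
    (((k.factorial : ℂ))⁻¹ * (s : ℂ) ^ k) * z ^ k * iteratedDeriv k g (t * z)
  have hT : ∀ k, PolyApprox U (T k) := fun k =>
    (ih _ (differentiableOn_iteratedDeriv_aux hU hg k)).monomial_mul hR hR0 _ k
  have hsz : ∀ z ∈ U, ‖(s : ℂ) * z‖ ≤ δ / 2 := by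
    intro z hz
    rw [norm_mul, Complex.norm_real, Real.norm_of_nonneg hs]
    exact (mul_le_mul_of_nonneg_left (hR z hz) hs).trans hsR
  have hbd : ∀ k, ∀ z ∈ U, ‖T k z‖ ≤ M * (1 / 2 : ℝ) ^ k := by
    intro k z hz
    have hd : DiffContOnCl ℂ g (ball ((t : ℂ) * z) δ) := by
      apply DifferentiableOn.diffContOnCl
      rw [closure_ball _ hδ.ne']
      exact hg.mono ((hball z hz).trans hKU)
    have h1 := Complex.norm_iteratedDeriv_le_of_forall_mem_sphere_norm_le k hδ hd
      (fun w hw => hM w (hball z hz (sphere_subset_closedBall hw)))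
    have hM0 : 0 ≤ M := (norm_nonneg _).trans
      (hM _ (hball z hz (mem_closedBall_self hδ.le)))
    have h3 : T k z = ((k.factorial : ℂ))⁻¹ * (s * z) ^ k * iteratedDeriv k g (t * z) := by
      simp only [T]; ring
    rw [h3, norm_mul, norm_mul, norm_pow, norm_inv, Complex.norm_natCast]
    have hk : (0:ℝ) < k.factorial := by exact_mod_cast k.factorial_pos
    calc ((k.factorial : ℝ))⁻¹ * ‖(s : ℂ) * z‖ ^ k * ‖iteratedDeriv k g (t * z)‖
        ≤ ((k.factorial : ℝ))⁻¹ * (δ / 2) ^ k * (k.factorial * M / δ ^ k) := by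
          gcongr
          exact hsz z hz
      _ = M * (1 / 2 : ℝ) ^ k := by
          rw [div_pow, div_pow]; field_simp; simp
  have hsum : Summable (fun k : ℕ => M * (1 / 2 : ℝ) ^ k) :=
    (summable_geometric_of_lt_one (by norm_num) (by norm_num)).mul_left M
  have hunif := tendstoUniformlyOn_tsum_nat hsum hbd
  refine PolyApprox.of_tendsto (fun N => PolyApprox.sum hT N) (hunif.congr_right ?_)
  intro z hz
  have hd : DifferentiableOn ℂ g (ball ((t : ℂ) * z) δ) :=
    hg.mono (ball_subset_closedBall.trans ((hball z hz).trans hKU))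
  have hmem : (((t + s : ℝ) : ℂ) * z) ∈ ball ((t : ℂ) * z) δ := by
    rw [mem_ball, dist_eq_norm]
    have : (((t + s : ℝ) : ℂ) * z) - t * z = s * z := by push_cast; ring
    rw [this]
    linarith [hsz z hz]
  have h := (Complex.hasSum_taylorSeries_on_ball hd hmem).tsum_eq
  refine Eq.trans ?_ h
  refine tsum_congr fun k => ?_
  simp only [T, smul_eq_mul]
  have : (((t + s : ℝ) : ℂ) * z) - t * z = s * z := by push_cast; ring
  rw [this]; ring

lemma runge_convex {U : Set ℂ} (hU : IsOpen U) (hc : Convex ℝ U) (hb : Bornology.IsBounded U)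
    (h0 : (0:ℂ) ∈ U) {r : ℝ} (hr0 : 0 ≤ r) (hr : r < 1)
    (g : ℂ → ℂ) (hg : DifferentiableOn ℂ g U) :
    PolyApprox U (fun z => g ((r : ℂ) * z)) := by
  obtain ⟨R, hR0, hR⟩ := hb.exists_pos_norm_le
  let K0 : Set ℂ := (fun p : ℝ × ℂ => (p.1 : ℂ) * p.2) '' (Icc 0 r ×ˢ closure U)
  have hK0 : IsCompact K0 := by
    apply (isCompact_Icc.prod hb.isCompact_closure).image
    fun_prop
  have hK0U : K0 ⊆ U := by
    rintro _ ⟨⟨t, z⟩, ⟨ht, hz⟩, rfl⟩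
    have := hc.combo_closure_interior_mem_interior hz (hU.interior_eq.symm ▸ h0) ht.1
      (show 0 < 1 - t by linarith [ht.2]) (by ring)
    rw [hU.interior_eq] at this
    simpa using this
  obtain ⟨δ, hδ, hδU⟩ := hK0.exists_cthickening_subset_open hU hK0U
  obtain ⟨N, hN⟩ := exists_nat_gt (r * R / (δ / 2))
  have hNpos : (0:ℝ) < N := lt_of_le_of_lt (by positivity) hN
  have hs : r / N * R ≤ δ / 2 := by
    rw [div_lt_iff₀ (by positivity)] at hN
    rw [div_mul_eq_mul_div, div_le_iff₀ hNpos]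
    linarith
  have key : ∀ k : ℕ, k ≤ N → ∀ g : ℂ → ℂ, DifferentiableOn ℂ g U →
      PolyApprox U (fun z => g (((k * (r / N) : ℝ) : ℂ) * z)) := by
    intro k
    induction k with
    | zero =>
      intro _ g _
      simpa using PolyApprox.const U (g 0)
    | succ k ih =>
      intro hk g hg
      have := runge_step hU hR hR0 hK0.cthickening hδU hδ (t := k * (r / N)) (s := r / N)
        (by positivity) hs (fun z hz => closedBall_subset_cthickening (by
          refine ⟨(k * (r / N), z), ⟨⟨by positivity, ?_⟩, subset_closure hz⟩, rfl⟩
          have : (k:ℝ) ≤ N := by exact_mod_cast (Nat.le_succ k).trans hk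
          calc (k:ℝ) * (r / N) ≤ N * (r / N) := by gcongr
            _ = r := by field_simp) δ) (ih ((Nat.le_succ k).trans hk)) g hg
      have e : ((k + 1 : ℕ) : ℝ) * (r / N) = k * (r / N) + r / N := by push_cast; ring
      rw [e]; exact this
  have := key N le_rfl g hg
  have e : (N:ℝ) * (r / N) = r := by field_simp
  rwa [e] at this

lemma dilation_approx {U : Set ℂ} (hU : IsOpen U) (hc : Convex ℝ U) (hb : Bornology.IsBounded U)
    (h0 : (0:ℂ) ∈ U) (f : ℂ → ℂ) (hfL2 : MemLp f 2 (volume.restrict U)) {e : ENNReal}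
    (he : e ≠ 0) : ∃ r : ℝ, 0 ≤ r ∧ r < 1 ∧
      eLpNorm (fun z => f z - f ((r:ℂ) * z)) 2 (volume.restrict U) ≤ e + e + 4 * e := by
  obtain ⟨R, hR0, hR⟩ := hb.exists_pos_norm_le
  have hF : MemLp (U.indicator f) 2 volume := (memLp_indicator_iff_restrict hU.measurableSet).2 hfL2
  set F := U.indicator f with hFdef
  obtain ⟨g, hgs, hge, hgc, hgL⟩ := hF.exists_hasCompactSupport_eLpNorm_sub_le (by simp) he
  have hvol : volume U ≠ ⊤ := hb.measure_lt_top.ne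
  obtain ⟨η, hη, hηe⟩ : ∃ η : ℝ, 0 < η ∧
      (volume U) ^ ((2:ENNReal).toReal⁻¹) * ENNReal.ofReal η ≤ e := by
    have ht : Tendsto (fun η : ℝ => (volume U) ^ ((2:ENNReal).toReal⁻¹) * ENNReal.ofReal η)
        (𝓝[>] 0) (𝓝 0) := by
      have h1 : Tendsto (fun η : ℝ => ENNReal.ofReal η) (𝓝[>] 0) (𝓝 0) := by
        have := (ENNReal.continuous_ofReal.tendsto 0).mono_left
          (nhdsWithin_le_nhds (s := Ioi (0:ℝ)))
        simpa using this
      have h2 := ENNReal.Tendsto.const_mul (a := (volume U) ^ ((2:ENNReal).toReal⁻¹)) h1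
        (Or.inr (ENNReal.rpow_ne_top_of_nonneg (by positivity) hvol))
      simpa using h2
    obtain ⟨η, h1, h2⟩ := ((ht.eventually (gt_mem_nhds (pos_iff_ne_zero.2 he))).and
      self_mem_nhdsWithin).exists
    exact ⟨η, h2, h1.le⟩
  obtain ⟨d, hd, hgd⟩ := Metric.uniformContinuous_iff.1
    (hgs.uniformContinuous_of_continuous hgc) η hη
  obtain ⟨a, ha0, ha1, had⟩ : ∃ a : ℝ, 0 < a ∧ a ≤ 1 / 2 ∧ a * R < d := by
    refine ⟨min (1 / 2) (d / (2 * R)), by positivity, min_le_left _ _, ?_⟩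
    calc min (1 / 2) (d / (2 * R)) * R ≤ d / (2 * R) * R := by gcongr; exact min_le_right _ _
      _ = d / 2 := by field_simp
      _ < d := by linarith
  refine ⟨1 - a, by linarith, by linarith, ?_⟩
  set r : ℝ := 1 - a with hr
  have hr12 : 1 / 2 ≤ r := by linarith
  have hr0 : r ≠ 0 := by linarith
  have hmF : AEStronglyMeasurable (F - g) volume := hF.1.sub hgL.1
  have hmap := Measure.map_addHaar_smul (volume : Measure ℂ) hr0
  have hqmp : Measure.QuasiMeasurePreserving (fun x : ℂ => r • x) volume volume := by
    refine ⟨by fun_prop, ?_⟩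
    rw [hmap]
    exact Measure.smul_absolutelyContinuous
  have hmF' : AEStronglyMeasurable ((F - g) ∘ fun x : ℂ => r • x) volume :=
    hmF.comp_quasiMeasurePreserving hqmp
  have h3 : eLpNorm ((F - g) ∘ fun x : ℂ => r • x) 2 volume ≤ 4 * e := by
    rw [← eLpNorm_map_measure (hmF.mono_ac hqmp.absolutelyContinuous) (by fun_prop), hmap,
      eLpNorm_smul_measure_of_ne_top (by simp), smul_eq_mul]
    refine mul_le_mul' ?_ hge
    have h4 : ENNReal.ofReal |(r ^ Module.finrank ℝ ℂ)⁻¹| ≤ 4 := by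
      rw [Complex.finrank_real_complex, abs_of_nonneg (by positivity)]
      refine ENNReal.ofReal_le_of_le_toReal ?_
      have : (1/4 : ℝ) ≤ r ^ 2 := by nlinarith
      calc (r ^ 2)⁻¹ ≤ (1 / 4 : ℝ)⁻¹ := by gcongr
        _ = _ := by norm_num
    calc _ ≤ (4:ENNReal) ^ (1 / 2 : ENNReal).toReal := ENNReal.rpow_le_rpow h4 (by positivity)
      _ ≤ (4:ENNReal) ^ (1:ℝ) := ENNReal.rpow_le_rpow_of_exponent_le (by norm_num) (by
          norm_num)
      _ = 4 := by simp
  have h2 : eLpNorm (fun z : ℂ => g z - g (r • z)) 2 (volume.restrict U) ≤ e := by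
    refine (eLpNorm_le_of_ae_bound (C := η) ?_).trans (by simpa using hηe)
    filter_upwards [ae_restrict_mem hU.measurableSet] with z hz
    rw [← dist_eq_norm]
    refine (hgd ?_).le
    rw [dist_eq_norm]
    have : z - r • z = a • z := by rw [hr, sub_smul, one_smul]; abel
    rw [this, norm_smul, Real.norm_of_nonneg ha0.le]
    exact (mul_le_mul_of_nonneg_left (hR z hz) ha0.le).trans_lt had
  have heq : eLpNorm (fun z => f z - f ((r:ℂ) * z)) 2 (volume.restrict U)
      = eLpNorm ((F - g) + (fun z : ℂ => g z - g (r • z)) - ((F - g) ∘ fun x : ℂ => r • x)) 2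
        (volume.restrict U) := by
    apply eLpNorm_congr_ae
    filter_upwards [ae_restrict_mem hU.measurableSet] with z hz
    have hz' : r • z ∈ U := by
      have := hc h0 hz ha0.le (show 0 ≤ r by linarith) (by rw [hr]; ring)
      simpa using this
    rw [Complex.real_smul] at hz'
    simp only [Pi.add_apply, Pi.sub_apply, Function.comp, hFdef, indicator_of_mem hz,
      Complex.real_smul, indicator_of_mem hz']
    ring
  have hmg : AEStronglyMeasurable (fun z : ℂ => g z - g (r • z)) (volume.restrict U) := by
    apply Continuous.aestronglyMeasurable
    fun_prop
  rw [heq]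
  refine (eLpNorm_sub_le (hmF.restrict.add hmg) hmF'.restrict (by norm_num)).trans ?_
  refine add_le_add ((eLpNorm_add_le hmF.restrict hmg (by norm_num)).trans (add_le_add ?_ h2)) ?_
  · exact (eLpNorm_mono_measure _ Measure.restrict_le_self).trans hge
  · exact (eLpNorm_mono_measure _ Measure.restrict_le_self).trans h3

lemma dense_zero {U : Set ℂ} (hU : IsOpen U) (hc : Convex ℝ U) (hb : Bornology.IsBounded U)
    (h0 : (0:ℂ) ∈ U) (f : ℂ → ℂ) (hf : DifferentiableOn ℂ f U)
    (hfL2 : MemLp f 2 (volume.restrict U)) (ε : ℝ) (hε : 0 < ε) :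
    ∃ h : Polynomial ℂ,
      eLpNorm (fun z => f z - h.eval z) 2 (volume.restrict U) < ENNReal.ofReal ε := by
  obtain ⟨r, hr0, hr1, hr⟩ := dilation_approx hU hc hb h0 f hfL2 (e := ENNReal.ofReal (ε / 12))
    (by simpa using hε)
  have hvol : volume U ≠ ⊤ := hb.measure_lt_top.ne
  have hV : (volume U) ^ ((2:ENNReal).toReal⁻¹) ≠ ⊤ :=
    ENNReal.rpow_ne_top_of_nonneg (by positivity) hvol
  set V := ((volume U) ^ ((2:ENNReal).toReal⁻¹)).toReal with hVdef
  have hV0 : 0 ≤ V := ENNReal.toReal_nonneg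
  obtain ⟨p, hp⟩ := runge_convex hU hc hb h0 hr0 hr1 f hf (ε / (4 * (V + 1))) (by positivity)
  refine ⟨p, ?_⟩
  have hmap : MapsTo (fun z : ℂ => (r:ℂ) * z) U U := by
    intro z hz
    have := hc h0 hz (show 0 ≤ 1 - r by linarith) hr0 (by ring)
    simpa using this
  have hfr : ContinuousOn (fun z => f ((r:ℂ) * z)) U :=
    hf.continuousOn.comp (by fun_prop) hmap
  have hm1 : AEStronglyMeasurable (fun z => f ((r:ℂ) * z)) (volume.restrict U) :=
    hfr.aestronglyMeasurable hU.measurableSet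
  have hm2 : AEStronglyMeasurable (fun z => p.eval z) (volume.restrict U) :=
    p.continuous.aestronglyMeasurable
  have h2 : eLpNorm (fun z => f ((r:ℂ) * z) - p.eval z) 2 (volume.restrict U)
      ≤ ENNReal.ofReal (ε / 4) := by
    refine (eLpNorm_le_of_ae_bound (C := ε / (4 * (V + 1))) ?_).trans ?_
    · filter_upwards [ae_restrict_mem hU.measurableSet] with z hz using hp z hz
    · rw [Measure.restrict_apply_univ, ← ENNReal.ofReal_toReal hV, ← hVdef,
        ← ENNReal.ofReal_mul hV0]
      apply ENNReal.ofReal_le_ofReal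
      rw [mul_div_assoc', div_le_div_iff₀ (by positivity) (by norm_num)]
      nlinarith
  have heq : (fun z => f z - p.eval z) = (fun z => f z - f ((r:ℂ) * z)) +
      (fun z => f ((r:ℂ) * z) - p.eval z) := by
    ext z; simp
  rw [heq]
  refine (eLpNorm_add_le (hfL2.1.sub hm1) (hm1.sub hm2) (by norm_num)).trans_lt ?_
  refine (add_le_add hr h2).trans_lt ?_
  have h4 : (4:ENNReal) = ENNReal.ofReal 4 := by simp
  rw [h4, ← ENNReal.ofReal_mul (by norm_num), ← ENNReal.ofReal_add (by positivity) (by positivity),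
    ← ENNReal.ofReal_add (by positivity) (by positivity),
    ← ENNReal.ofReal_add (by positivity) (by positivity)]
  rw [ENNReal.ofReal_lt_ofReal_iff hε]
  linarith

/-- Holomorphic polynomials are dense in the Bergman space of a bounded convex domain
in `ℂ`. -/
theorem polynomials_dense_in_bergman_space
    (U : Set ℂ) (hUopen : IsOpen U) (hUne : U.Nonempty)
    (hUconv : Convex ℝ U) (hUbdd : Bornology.IsBounded U)
    (f : ℂ → ℂ) (hf : DifferentiableOn ℂ f U)
    (hfL2 : MemLp f 2 (volume.restrict U)) :
    ∀ ε > (0:ℝ), ∃ h : Polynomial ℂ,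
      eLpNorm (fun z => f z - h.eval z) 2 (volume.restrict U) < ENNReal.ofReal ε := by
  intro ε hε
  obtain ⟨c, hcU⟩ := hUne
  let φ : ℂ → ℂ := fun z => z + c
  have hφ : MeasurePreserving φ volume volume := measurePreserving_add_right volume c
  have hφU := hφ.restrict_preimage hUopen.measurableSet
  have hφc : Continuous φ := by fun_prop
  have hconv : Convex ℝ (φ ⁻¹' U) := hUconv.translate_preimage_left c
  have hbdd : Bornology.IsBounded (φ ⁻¹' U) := by
    obtain ⟨R, hR0, hR⟩ := hUbdd.exists_pos_norm_le
    refine isBounded_iff_forall_norm_le.2 ⟨R + ‖c‖, fun z hz => ?_⟩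
    have h1 := hR _ hz
    have h2 := norm_sub_le (z + c) c
    rw [add_sub_cancel_right] at h2
    simp only [φ] at h1
    linarith
  obtain ⟨h, hh⟩ := dense_zero (hUopen.preimage hφc) hconv hbdd (by simpa [φ] using hcU)
    (f ∘ φ) (hf.comp (by fun_prop) (mapsTo_preimage φ U)) (hfL2.comp_measurePreserving hφU) ε hε
  refine ⟨h.comp (Polynomial.X - Polynomial.C c), ?_⟩
  have hm : AEStronglyMeasurable
      (fun z => f z - (h.comp (Polynomial.X - Polynomial.C c)).eval z) (volume.restrict U) :=
    hfL2.1.sub (Polynomial.continuous _).aestronglyMeasurable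
  rw [← eLpNorm_comp_measurePreserving hm hφU]
  convert hh using 2
  ext z
  simp [φ]
end

section
/- Let η : ℂ → ℂ be continuous and let f be an entire function. Then the function G(z, r) = (1/π)∫_{𝔻_r} r²·(r² − z·conj(ξ))^{−2}·η(ξ)·f(ξ) dA(ξ), i.e. G(z, r) = P^{𝔻_r}(ηf)(z), is continuous on the set {(z, r) ∈ ℂ × (0, ∞) : |z| < r}. -/
open MeasureTheory Metric Complex Filter Set Topology

/-- `(z, r) ↦ P^{𝔻_r}(η f)(z)` is continuous on `{(z, r) : |z| < r}`. -/
theorem disk_projection_jointly_continuous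
    (η : ℂ → ℂ) (hη : Continuous η) (f : ℂ → ℂ) (hf : Differentiable ℂ f) :
    ContinuousOn (fun p : ℂ × ℝ => diskProj p.2 (fun ξ => η ξ * f ξ) p.1)
      {p : ℂ × ℝ | ‖p.1‖ < p.2} := by
  rintro ⟨z0, r0⟩ hp
  simp only [Set.mem_setOf_eq] at hp
  apply ContinuousAt.continuousWithinAt
  have hu : Continuous (fun ξ => η ξ * f ξ) := hη.mul hf.continuous
  generalize (fun ξ => η ξ * f ξ) = u at hu
  unfold diskProj
  refine ContinuousAt.mul continuousAt_const ?_
  simp only [← integral_indicator measurableSet_ball]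
  obtain ⟨a, ha1, hap⟩ := exists_between hp
  obtain ⟨b, hab, hbr⟩ := exists_between hap
  have hr0 : 0 < r0 := lt_of_le_of_lt (norm_nonneg _) hp
  obtain ⟨M, hM⟩ := (isCompact_closedBall (0:ℂ) (r0+1)).exists_bound_of_continuousOn
    hu.continuousOn
  refine continuousAt_of_dominated
    (bound := (ball (0:ℂ) (r0+1)).indicator (fun _ => 1 / (b-a)^2 * M)) ?_ ?_ ?_ ?_
  · refine Eventually.of_forall fun p => ?_
    refine (Measurable.indicator ?_ measurableSet_ball).aestronglyMeasurable
    have h1 : Measurable u := hu.measurable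
    have h2 : Measurable (fun ξ : ℂ => (starRingEnd ℂ) ξ) := Complex.continuous_conj.measurable
    exact (measurable_const.div ((measurable_const.sub (measurable_const.mul h2)).pow_const 2)).mul h1
  · have e1 : ∀ᶠ p : ℂ × ℝ in 𝓝 (z0, r0), ‖p.1‖ < a :=
      (continuous_fst.norm.tendsto (z0, r0)).eventually (gt_mem_nhds ha1)
    have e2 : ∀ᶠ p : ℂ × ℝ in 𝓝 (z0, r0), b < p.2 :=
      (continuous_snd.tendsto (z0, r0)).eventually (lt_mem_nhds hbr)
    have e3 : ∀ᶠ p : ℂ × ℝ in 𝓝 (z0, r0), p.2 < r0 + 1 :=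
      (continuous_snd.tendsto (z0, r0)).eventually (gt_mem_nhds (by simp))
    filter_upwards [e1, e2, e3] with p h1 h2 h3
    refine Eventually.of_forall fun ξ => ?_
    by_cases hξ : ξ ∈ ball (0:ℂ) p.2
    · have hξ' : ξ ∈ ball (0:ℂ) (r0+1) := ball_subset_ball h3.le hξ
      rw [indicator_of_mem hξ, indicator_of_mem hξ', norm_mul]
      rw [mem_ball_zero_iff] at hξ
      have hMu := hM ξ (ball_subset_closedBall hξ')
      have hr : 0 < p.2 := lt_of_le_of_lt (norm_nonneg _) hξ
      have hn := norm_nonneg p.1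
      have hd : p.2 * (b - a) ≤ ‖(p.2:ℂ)^2 - p.1 * (starRingEnd ℂ) ξ‖ := by
        have := norm_sub_norm_le ((p.2:ℂ)^2) (p.1 * (starRingEnd ℂ) ξ)
        rw [norm_mul, norm_pow, RCLike.norm_conj, Complex.norm_real, Real.norm_of_nonneg hr.le] at this
        nlinarith [mul_le_mul_of_nonneg_left hξ.le hn]
      have hba : 0 < b - a := sub_pos.2 hab
      gcongr
      rw [norm_div, norm_pow, norm_pow, Complex.norm_real, Real.norm_of_nonneg hr.le]
      calc p.2^2 / ‖(p.2:ℂ)^2 - p.1 * (starRingEnd ℂ) ξ‖^2 ≤ p.2^2 / (p.2 * (b-a))^2 := by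
            gcongr
        _ = 1 / (b-a)^2 := by field_simp
    · rw [indicator_of_notMem hξ, norm_zero]
      refine indicator_nonneg (fun x hx => ?_) ξ
      have := (norm_nonneg _).trans (hM x (ball_subset_closedBall hx))
      positivity
  · exact (integrable_indicator_iff measurableSet_ball).2
      (integrableOn_const (measure_ball_lt_top.ne))
  · have hs : ∀ᵐ ξ : ℂ, ξ ∉ sphere (0:ℂ) r0 :=
      measure_eq_zero_iff_ae_notMem.1 (Measure.addHaar_sphere _ _ _)
    filter_upwards [hs] with ξ hξ
    rw [mem_sphere_zero_iff_norm] at hξ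
    rcases lt_or_gt_of_ne hξ with h | h
    · have e : ∀ᶠ p : ℂ × ℝ in 𝓝 (z0, r0), ‖ξ‖ < p.2 :=
        (continuous_snd.tendsto (z0, r0)).eventually (lt_mem_nhds h)
      have hd : ((r0:ℂ)^2 - z0 * (starRingEnd ℂ) ξ)^2 ≠ 0 := by
        apply pow_ne_zero
        intro h0
        have := congrArg norm (sub_eq_zero.1 h0)
        rw [norm_mul, norm_pow, RCLike.norm_conj, Complex.norm_real, Real.norm_of_nonneg hr0.le] at this
        nlinarith [norm_nonneg z0, norm_nonneg ξ]
      have hc : ContinuousAt (fun p : ℂ × ℝ =>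
          (p.2:ℂ)^2 / ((p.2:ℂ)^2 - p.1 * (starRingEnd ℂ) ξ)^2 * u ξ) (z0, r0) := by
        refine ContinuousAt.mul (ContinuousAt.div ?_ ?_ hd) continuousAt_const
        · fun_prop
        · fun_prop
      refine hc.congr ?_
      filter_upwards [e] with p hp
      rw [indicator_of_mem (mem_ball_zero_iff.2 hp)]
    · have e : ∀ᶠ p : ℂ × ℝ in 𝓝 (z0, r0), p.2 < ‖ξ‖ :=
        (continuous_snd.tendsto (z0, r0)).eventually (gt_mem_nhds h)
      refine (continuousAt_const (y := (0:ℂ))).congr ?_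
      filter_upwards [e] with p hp
      rw [indicator_of_notMem]
      rw [mem_ball_zero_iff]
      exact hp.not_gt
end
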